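/- For every integer g ≥ 1 and every τ ∈ ℍ_g, the genus-g theta series of the E₈ and D₁₆⁺ lattices are averages of powers of theta constants: f₄^{(g)}(τ) = 2^{−g}·Σ_{m∈𝔽₂^{2g}} θ_m(τ)⁸ and f₈^{(g)}(τ) = 2^{−g}·Σ_{m∈𝔽₂^{2g}} θ_m(τ)^{16}. -/

import Mathlib

open scoped BigOperators

noncomputable section

/-- The Siegel upper half-space: symmetric complex matrices with positive
definite imaginary part (indexed by a finite type `ι`). -/
def Siegel (ι : Type) [Fintype ι] : Set (Matrix ι ι ℂ) :=
  {τ | τ.IsSymm ∧ ∀ v : ι → ℝ, v ≠ 0 → 0 < ∑ i, ∑ j, v i * (τ i j).im * v j}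

/-- The theta function with characteristic `[ε, δ]`. -/
def theta {ι : Type} [Fintype ι] (ε δ : ι → ZMod 2) (τ : Matrix ι ι ℂ) (z : ι → ℂ) : ℂ :=
  ∑' n : ι → ℤ, Complex.exp ((Real.pi : ℂ) * Complex.I *
    ((∑ i, ∑ j, ((n i : ℂ) + ((ε i).val : ℂ) / 2) * τ i j * ((n j : ℂ) + ((ε j).val : ℂ) / 2)) +
     2 * ∑ i, ((n i : ℂ) + ((ε i).val : ℂ) / 2) * (z i + ((δ i).val : ℂ) / 2)))

/-- A theta characteristic, an element of `𝔽₂^{2g}`. -/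
abbrev Char2 (ι : Type) := (ι → ZMod 2) × (ι → ZMod 2)

/-- Theta function, with the characteristic as a pair. -/
def thetaChar {ι : Type} [Fintype ι] (m : Char2 ι) (τ : Matrix ι ι ℂ) (z : ι → ℂ) : ℂ :=
  theta m.1 m.2 τ z

/-- Theta constant. -/
def thetaConst {ι : Type} [Fintype ι] (m : Char2 ι) (τ : Matrix ι ι ℂ) : ℂ :=
  thetaChar m τ 0

/-- The even unimodular lattice `{x ∈ ℤ^k ∪ (ℤ+1/2)^k : Σᵢ xᵢ ∈ 2ℤ}` (the `E₈` lattice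
for `k = 8`, the `D₁₆⁺` lattice for `k = 16`). -/
def evenLattice (k : ℕ) : Set (Fin k → ℝ) :=
  {x | ((∀ i, ∃ n : ℤ, x i = n) ∨ (∀ i, ∃ n : ℤ, x i = n + 1/2)) ∧
        ∃ m : ℤ, ∑ i, x i = 2 * m}

/-- The genus-`g` theta series of the lattice `evenLattice k`; for `k = 8` this is
`f₄^{(g)}` and for `k = 16` this is `f₈^{(g)}`. -/
noncomputable def latticeTheta (k : ℕ) (ι : Type) [Fintype ι] (τ : Matrix ι ι ℂ) : ℂ :=
  ∑' u : ι → evenLattice k, Complex.exp ((Real.pi : ℂ) * Complex.I *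
    ∑ a, ∑ b, (((∑ i, (u a : Fin k → ℝ) i * (u b : Fin k → ℝ) i : ℝ)) : ℂ) * τ a b)

/-- A finite product of absolutely convergent series is the absolutely convergent series of the
products over all tuples of indices. -/
theorem summable_norm_prod_and_prod_tsum {R α : Type*} [NormedCommRing R] [NormOneClass R]
    [CompleteSpace R] (k : ℕ) (f : Fin k → α → R) (hf : ∀ l, Summable fun a => ‖f l a‖) :
    (Summable fun N : Fin k → α => ‖∏ l, f l (N l)‖) ∧
      ∏ l, ∑' a, f l a = ∑' N : Fin k → α, ∏ l, f l (N l) := by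
  induction k with
  | zero => exact ⟨(hasSum_fintype _).summable, by simp⟩
  | succ k ih =>
    obtain ⟨hs, ht⟩ := ih (fun l => f l.succ) fun l => hf l.succ
    constructor
    · rw [← (Fin.consEquiv fun _ => α).summable_iff]
      simpa [Function.comp_def, Fin.consEquiv, Fin.prod_univ_succ] using (hf 0).mul_norm hs
    · rw [← (Fin.consEquiv fun _ => α).tsum_eq, Fin.prod_univ_succ, ht,
        tsum_mul_tsum_of_summable_norm (hf 0) hs]
      simp [Fin.consEquiv, Fin.prod_univ_succ]

/-- A positive definite quadratic form dominates a multiple of the sum of squares. -/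
theorem exists_pos_mul_sum_sq_le {ι : Type*} [Fintype ι] (Y : ι → ι → ℝ)
    (hY : ∀ v : ι → ℝ, v ≠ 0 → 0 < ∑ i, ∑ j, v i * Y i j * v j) :
    ∃ c : ℝ, 0 < c ∧ ∀ v : ι → ℝ, c * ∑ i, v i ^ 2 ≤ ∑ i, ∑ j, v i * Y i j * v j := by
  let q : (ι → ℝ) → ℝ := fun v => ∑ i, ∑ j, v i * Y i j * v j
  let S : Set (ι → ℝ) := {v | ∑ i, v i ^ 2 = 1}
  have hScl : IsClosed S := isClosed_eq (by fun_prop) continuous_const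
  have hSb : S ⊆ Set.pi Set.univ fun _ => Set.Icc (-1 : ℝ) 1 := fun v hv i _ => by
    have h : v i ^ 2 ≤ 1 := by
      rw [← show ∑ i, v i ^ 2 = 1 from hv]
      exact Finset.single_le_sum (f := fun i => v i ^ 2) (fun _ _ => sq_nonneg _)
        (Finset.mem_univ i)
    exact abs_le.mp (by rwa [sq_le_one_iff_abs_le_one] at h)
  have hSc : IsCompact S := (isCompact_univ_pi fun _ => isCompact_Icc).of_isClosed_subset hScl hSb
  have hne : ∀ v ∈ S, v ≠ 0 := by
    rintro v hv rfl
    simp [S] at hv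
  obtain ⟨c, hc, hcS⟩ : ∃ c : ℝ, 0 < c ∧ ∀ v ∈ S, c ≤ q v := by
    rcases S.eq_empty_or_nonempty with h | h
    · exact ⟨1, one_pos, by simp [h]⟩
    · obtain ⟨v, hv, hmin⟩ := hSc.exists_isMinOn h
        (show ContinuousOn q S by fun_prop)
      exact ⟨q v, hY v (hne v hv), fun w hw => hmin hw⟩
  refine ⟨c, hc, fun v => ?_⟩
  rcases eq_or_ne v 0 with rfl | hv
  · simp
  have hpos : 0 < ∑ i, v i ^ 2 := by
    obtain ⟨i, hi⟩ := Function.ne_iff.mp hv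
    exact Finset.sum_pos' (fun _ _ => sq_nonneg _) ⟨i, Finset.mem_univ i, by
      have : v i ≠ 0 := hi
      positivity⟩
  set s := ∑ i, v i ^ 2 with hs
  have hsq : Real.sqrt s ^ 2 = s := Real.sq_sqrt hpos.le
  have hsq0 : Real.sqrt s ≠ 0 := (Real.sqrt_pos.mpr hpos).ne'
  have hmem : (fun i => v i / Real.sqrt s) ∈ S := by
    simp only [S, Set.mem_ofPred_eq, div_pow, ← Finset.sum_div, hsq, ← hs]
    exact div_self hpos.ne'
  have hq : q (fun i => v i / Real.sqrt s) = q v / s := by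
    simp only [q, Finset.sum_div]
    refine Finset.sum_congr rfl fun i _ => Finset.sum_congr rfl fun j _ => ?_
    rw [show v i * Y i j * v j / s = v i * Y i j * v j / Real.sqrt s ^ 2 by rw [hsq]]
    field_simp
  have := hcS _ hmem
  rwa [hq, le_div_iff₀ hpos] at this

/-- The Gaussian series over a shift of the integers converges. -/
theorem summable_exp_neg_mul_int_add_sq {c : ℝ} (hc : 0 < c) (e : ℝ) :
    Summable fun n : ℤ => Real.exp (-Real.pi * (c * (n + e) ^ 2)) := by
  have h := ((summable_jacobiTheta₂_term_iff (c * e * Complex.I) (c * Complex.I)).mpr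
    (by simpa using hc)).norm.mul_left (Real.exp (-Real.pi * (c * e ^ 2)))
  refine h.congr fun n => ?_
  rw [norm_jacobiTheta₂_term, ← Real.exp_add]
  congr 1
  simp
  ring

/-- The vector `n + ε / 2`. -/
def halfShift {ι : Type*} (ε : ι → ZMod 2) (n : ι → ℤ) (i : ι) : ℝ :=
  n i + ((ε i).val : ℝ) / 2

/-- The general term of the series defining the theta constant of characteristic `[ε, δ]`. -/
def thetaConstTerm {ι : Type*} [Fintype ι] (ε δ : ι → ZMod 2) (τ : Matrix ι ι ℂ) (n : ι → ℤ) : ℂ :=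
  Complex.exp ((Real.pi : ℂ) * Complex.I *
    ((∑ i, ∑ j, (halfShift ε n i : ℂ) * τ i j * (halfShift ε n j : ℂ)) +
      ∑ i, (halfShift ε n i : ℂ) * ((δ i).val : ℂ)))

theorem thetaConst_eq_tsum {ι : Type} [Fintype ι] (ε δ : ι → ZMod 2) (τ : Matrix ι ι ℂ) :
    thetaConst (ε, δ) τ = ∑' n, thetaConstTerm ε δ τ n := by
  unfold thetaConst thetaChar theta thetaConstTerm halfShift
  refine tsum_congr fun n => ?_
  congr 2
  push_cast
  rw [Finset.mul_sum]
  congr 1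
  refine Finset.sum_congr rfl fun i _ => ?_
  simp
  ring

theorem norm_thetaConstTerm {ι : Type*} [Fintype ι] (ε δ : ι → ZMod 2) (τ : Matrix ι ι ℂ)
    (n : ι → ℤ) :
    ‖thetaConstTerm ε δ τ n‖ = Real.exp (-Real.pi *
      ∑ i, ∑ j, halfShift ε n i * (τ i j).im * halfShift ε n j) := by
  rw [thetaConstTerm, Complex.norm_exp]
  congr 1
  simp [Complex.mul_re, Complex.mul_im, Complex.im_sum, -ZMod.natCast_val]

theorem summable_norm_thetaConstTerm {g : ℕ} (ε δ : Fin g → ZMod 2)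
    {τ : Matrix (Fin g) (Fin g) ℂ} (hτ : τ ∈ Siegel (Fin g)) :
    Summable fun n => ‖thetaConstTerm ε δ τ n‖ := by
  obtain ⟨c, hc, hle⟩ := exists_pos_mul_sum_sq_le (fun i j => (τ i j).im) hτ.2
  have hs := (summable_norm_prod_and_prod_tsum g
    (fun i (n : ℤ) => Real.exp (-Real.pi * (c * (n + ((ε i).val : ℝ) / 2) ^ 2)))
    fun i => (summable_exp_neg_mul_int_add_sq hc _).norm).1
  refine Summable.of_nonneg_of_le (fun _ => norm_nonneg _) (fun n => ?_) hs
  rw [norm_thetaConstTerm, ← Real.exp_sum, Real.norm_eq_abs, Real.abs_exp, Real.exp_le_exp,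
    ← Finset.mul_sum, ← Finset.mul_sum]
  exact mul_le_mul_of_nonpos_left (hle (halfShift ε n)) (neg_nonpos.mpr Real.pi_pos.le)

/-- The `a`-th of the vectors of length `k` encoded by a characteristic and a tuple of integral
vectors. -/
def halfShiftRow {ι κ : Type*} (p : (ι → ZMod 2) × (κ → ι → ℤ)) (a : ι) (l : κ) : ℝ :=
  halfShift p.1 (p.2 l) a

theorem halfShiftRow_injective {ι κ : Type*} [Nonempty κ] :
    Function.Injective (halfShiftRow : (ι → ZMod 2) × (κ → ι → ℤ) → ι → κ → ℝ) := by
  rintro ⟨ε, N⟩ ⟨ε', N'⟩ h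
  have key : ∀ a l, ε a = ε' a ∧ N l a = N' l a := fun a l => by
    have h' : (N l a : ℝ) + ((ε a).val : ℝ) / 2 = N' l a + ((ε' a).val : ℝ) / 2 :=
      congrFun (congrFun h a) l
    have h2 : 2 * N l a + ((ε a).val : ℤ) = 2 * N' l a + ((ε' a).val : ℤ) := by
      have : 2 * (N l a : ℝ) + ((ε a).val : ℝ) = 2 * N' l a + ((ε' a).val : ℝ) := by linarith
      exact_mod_cast this
    have h3 := ZMod.val_lt (ε a)
    have h4 := ZMod.val_lt (ε' a)
    exact ⟨ZMod.val_injective 2 (by omega), by omega⟩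
  obtain ⟨l₀⟩ := ‹Nonempty κ›
  exact Prod.ext (funext fun a => (key a l₀).1) (funext fun l => funext fun a => (key a l).2)

theorem halfShiftRow_mem_evenLattice_iff {ι : Type*} {k : ℕ}
    (p : (ι → ZMod 2) × (Fin k → ι → ℤ)) (a : ι) :
    halfShiftRow p a ∈ evenLattice k ↔ ∃ m : ℤ, ∑ l, halfShiftRow p a l = 2 * m := by
  refine ⟨fun h => h.2, fun h => ⟨?_, h⟩⟩
  have h2 := ZMod.val_lt (p.1 a)
  obtain h0 | h1 : (p.1 a).val = 0 ∨ (p.1 a).val = 1 := by omega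
  · exact Or.inl fun l => ⟨p.2 l a, by simp [halfShiftRow, halfShift, h0]⟩
  · exact Or.inr fun l => ⟨p.2 l a, by simp [halfShiftRow, halfShift, h1]⟩

theorem exists_halfShiftRow_eq {ι : Type*} {k : ℕ} (u : ι → evenLattice k) :
    ∃ p : (ι → ZMod 2) × (Fin k → ι → ℤ), ∀ a, halfShiftRow p a = u a := by
  have h : ∀ a, ∃ (e : ZMod 2) (x : Fin k → ℤ), ∀ l, (x l : ℝ) + (e.val : ℝ) / 2 = (u a).1 l := by
    intro a
    rcases (u a).2.1 with h | h <;> choose x hx using h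
    · exact ⟨0, x, fun l => by simp [hx]⟩
    · exact ⟨1, x, fun l => by simp [hx, ZMod.val_one]⟩
  choose ε x hx using h
  exact ⟨(ε, fun l a => x a l), fun a => funext fun l => hx a l⟩

theorem prod_thetaConstTerm {ι : Type*} [Fintype ι] {k : ℕ} (δ : ι → ZMod 2) (τ : Matrix ι ι ℂ)
    (p : (ι → ZMod 2) × (Fin k → ι → ℤ)) :
    ∏ l, thetaConstTerm p.1 δ τ (p.2 l) =
      Complex.exp ((Real.pi : ℂ) * Complex.I * ∑ a, ∑ b,
        ((∑ l, halfShiftRow p a l * halfShiftRow p b l : ℝ) : ℂ) * τ a b) *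
      ∏ a, Complex.exp ((Real.pi : ℂ) * Complex.I * (∑ l, halfShiftRow p a l : ℝ)) ^ (δ a).val := by
  simp only [thetaConstTerm, ← Complex.exp_sum, ← Complex.exp_nat_mul, ← Complex.exp_add,
    ← Finset.mul_sum, Finset.sum_add_distrib, mul_add]
  congr 2
  · congr 1
    rw [Finset.sum_comm]
    refine Finset.sum_congr rfl fun a _ => ?_
    rw [Finset.sum_comm]
    refine Finset.sum_congr rfl fun b _ => ?_
    push_cast
    rw [Finset.sum_mul]
    refine Finset.sum_congr rfl fun l _ => ?_
    simp only [halfShiftRow]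
    ring
  · rw [Finset.sum_comm, Finset.mul_sum]
    refine Finset.sum_congr rfl fun a _ => ?_
    rw [← Finset.sum_mul]
    push_cast
    simp only [halfShiftRow]
    ring

theorem exp_pi_mul_I_mul_int (m : ℤ) :
    Complex.exp ((Real.pi : ℂ) * Complex.I * (m : ℝ)) = (-1) ^ m := by
  rw [← Complex.exp_pi_mul_I, ← Complex.exp_int_mul]
  congr 1
  push_cast
  ring

/-- Summing over the second half of the characteristic projects onto the tuples of vectors of even
coordinate sum. -/
theorem sum_prod_thetaConstTerm {ι : Type*} [Fintype ι] [DecidableEq ι] {k : ℕ} (hk : Even k)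
    (τ : Matrix ι ι ℂ) (p : (ι → ZMod 2) × (Fin k → ι → ℤ))
    [Decidable (∀ a, halfShiftRow p a ∈ evenLattice k)] :
    ∑ δ : ι → ZMod 2, ∏ l, thetaConstTerm p.1 δ τ (p.2 l) =
      if ∀ a, halfShiftRow p a ∈ evenLattice k then
        2 ^ Fintype.card ι * Complex.exp ((Real.pi : ℂ) * Complex.I * ∑ a, ∑ b,
          ((∑ l, halfShiftRow p a l * halfShiftRow p b l : ℝ) : ℂ) * τ a b)
      else 0 := by
  have hint : ∀ a, ∃ m : ℤ, ∑ l, halfShiftRow p a l = m := fun a => by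
    obtain ⟨r, rfl⟩ := hk
    refine ⟨∑ l, p.2 l a + r * (p.1 a).val, ?_⟩
    simp [halfShiftRow, halfShift, Finset.sum_add_distrib, -ZMod.natCast_val]
    ring
  choose m hm using hint
  have hmem : ∀ a, halfShiftRow p a ∈ evenLattice k ↔ Even (m a) := fun a => by
    rw [halfShiftRow_mem_evenLattice_iff, hm, even_iff_exists_two_mul]
    exact exists_congr fun c => by norm_cast
  simp only [prod_thetaConstTerm, ← Finset.mul_sum, hm, exp_pi_mul_I_mul_int, hmem]
  have hsum : ∑ δ : ι → ZMod 2, ∏ a, ((-1 : ℂ) ^ m a) ^ (δ a).val = ∏ a, (1 + (-1) ^ m a) := by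
    have := Finset.prod_univ_sum (fun _ : ι => (Finset.univ : Finset (ZMod 2)))
      fun a d => ((-1 : ℂ) ^ m a) ^ d.val
    rw [Fintype.piFinset_univ] at this
    rw [← this]
    refine Finset.prod_congr rfl fun a _ => ?_
    rw [show (Finset.univ : Finset (ZMod 2)) = {0, 1} from rfl,
      Finset.sum_pair (by decide)]
    simp [ZMod.val_one]
  rw [hsum]
  split_ifs with h
  · rw [mul_comm]
    congr 1
    rw [Finset.prod_congr rfl fun a _ => by rw [(h a).neg_one_zpow, one_add_one_eq_two]]
    simp
  · push Not at h
    obtain ⟨a, ha⟩ := h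
    rw [Finset.prod_eq_zero (Finset.mem_univ a), mul_zero]
    rw [(Int.not_even_iff_odd.mp ha).neg_one_zpow, add_neg_cancel]

/-- The theta series of the lattice `evenLattice k` is an average of `k`-th powers of theta
constants, for every even `k > 0`. -/
theorem latticeTheta_eq_average {g k : ℕ} (hk : Even k) (hk0 : k ≠ 0)
    {τ : Matrix (Fin g) (Fin g) ℂ} (hτ : τ ∈ Siegel (Fin g)) :
    latticeTheta k (Fin g) τ = (2 : ℂ)⁻¹ ^ g * ∑ m : Char2 (Fin g), thetaConst m τ ^ k := by
  classical
  have : NeZero k := ⟨hk0⟩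
  have hprod := fun ε δ : Fin g → ZMod 2 => summable_norm_prod_and_prod_tsum k
    (fun _ => thetaConstTerm ε δ τ) fun _ => summable_norm_thetaConstTerm ε δ hτ
  let H : (Fin g → ZMod 2) × (Fin k → Fin g → ℤ) → ℂ := fun p =>
    ∑ δ : Fin g → ZMod 2, ∏ l, thetaConstTerm p.1 δ τ (p.2 l)
  have hHs : Summable H := by
    refine summable_sum fun δ _ => Summable.of_norm ?_
    refine (summable_prod_of_nonneg fun _ => norm_nonneg _).mpr
      ⟨fun ε => (hprod ε δ).1, (hasSum_fintype _).summable⟩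
  choose ψ hψ using fun u : Fin g → evenLattice k => exists_halfShiftRow_eq u
  have hψinj : Function.Injective ψ := fun u v h => funext fun a => Subtype.ext <| by
    rw [← hψ u a, ← hψ v a, h]
  have hsupp : Function.support H ⊆ Set.range ψ := fun p hp => by
    have hmem : ∀ a, halfShiftRow p a ∈ evenLattice k := by
      by_contra h
      exact hp ((sum_prod_thetaConstTerm hk τ p).trans (if_neg h))
    exact ⟨fun a => ⟨_, hmem a⟩, halfShiftRow_injective (funext fun a => hψ _ a)⟩
  have hHψ : ∀ u, H (ψ u) = 2 ^ g * Complex.exp ((Real.pi : ℂ) * Complex.I *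
      ∑ a, ∑ b, ((∑ i, (u a : Fin k → ℝ) i * (u b : Fin k → ℝ) i : ℝ) : ℂ) * τ a b) := fun u => by
    refine (sum_prod_thetaConstTerm hk τ (ψ u)).trans ?_
    rw [if_pos fun a => by rw [hψ]; exact (u a).2]
    simp only [hψ, Fintype.card_fin]
  have hsum : ∑' p, H p = ∑ m : Char2 (Fin g), thetaConst m τ ^ k := by
    rw [hHs.tsum_prod, tsum_fintype, Fintype.sum_prod_type]
    refine Finset.sum_congr rfl fun ε _ => ?_
    rw [Summable.tsum_finsetSum fun δ _ => (hprod ε δ).1.of_norm]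
    refine Finset.sum_congr rfl fun δ _ => ?_
    rw [← (hprod ε δ).2, thetaConst_eq_tsum]
    simp
  rw [← hsum, ← hψinj.tsum_eq hsupp, tsum_congr hHψ, tsum_mul_left, ← mul_assoc, ← mul_pow,
    inv_mul_cancel₀ two_ne_zero, one_pow, one_mul, latticeTheta]

/-- The genus-`g` theta series of the `E₈` and `D₁₆⁺` lattices are averages of
eighth and sixteenth powers of theta constants. -/
theorem lattice_theta_eq_average_of_theta_constants (g : ℕ) (hg : 1 ≤ g)
    (τ : Matrix (Fin g) (Fin g) ℂ) (hτ : τ ∈ Siegel (Fin g)) :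
    latticeTheta 8 (Fin g) τ = (2 : ℂ)⁻¹ ^ g * ∑ m : Char2 (Fin g), thetaConst m τ ^ 8 ∧
    latticeTheta 16 (Fin g) τ = (2 : ℂ)⁻¹ ^ g * ∑ m : Char2 (Fin g), thetaConst m τ ^ 16 := by
  exact ⟨latticeTheta_eq_average (by decide) (by decide) hτ,
    latticeTheta_eq_average (by decide) (by decide) hτ⟩
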